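/- arXiv:2010.12460 — 2 statements merged into one kernel-verified Lean document; each statement's English description precedes it below -/
import Mathlib

section
/- Let v ∈ ℝ^d, q ≥ 1, and let Q_ℓ(v) be unbiased stochastic quantization with levels 0 = ℓ_0 < ℓ_1 < ... < ℓ_{s+1} = 1 under L^q normalization: each coordinate r_i = |v_i|/‖v‖_q in bin [ℓ_j, ℓ_{j+1}] is rounded to the endpoints with probabilities proportional to distance, so the per-coordinate variance is (ℓ_{j+1}-r_i)(r_i-ℓ_j). Then for any p ∈ (0,1), E[‖Q_ℓ(v) - v‖_2^2] ≤ ε_Q ‖v‖_2^2 with ε_Q = (ℓ_{j*+1}/ℓ_{j*} - 1)^2/(4 ℓ_{j*+1}/ℓ_{j*}) + K_p ℓ_1^{2-p} d^{(2-p)/min(q,2)}, where j* = argmax_{1≤j≤s} ℓ_{j+1}/ℓ_j and K_p = (1/(2-p))((1-p)/(2-p))^{1-p}. -/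
lemma aux_pow (d : ℕ) (v : Fin d → ℝ) (M t : ℝ) (hM : 0 ≤ M) (hM2 : ∑ i, v i ^ 2 = M ^ 2)
    (ht : 0 < t) (ht2 : t ≤ 2) :
    ∑ i, |v i| ^ t ≤ (d : ℝ) ^ (1 - t / 2) * M ^ t := by
  have h1 : 1 ≤ 2 / t := by rw [le_div_iff₀ ht]; linarith
  have h := Real.rpow_sum_le_const_mul_sum_rpow Finset.univ (fun i => |v i| ^ t) h1
  have e : ∀ i, |(|v i| ^ t)| ^ (2 / t) = v i ^ 2 := by
    intro i
    rw [abs_of_nonneg (by positivity), ← Real.rpow_mul (abs_nonneg _)]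
    rw [show t * (2 / t) = (2 : ℕ) by push_cast; field_simp, Real.rpow_natCast, sq_abs]
  have e2 : ∀ i, |(|v i| ^ t)| = |v i| ^ t := fun i => abs_of_nonneg (by positivity)
  simp only [e, hM2, Finset.card_univ, Fintype.card_fin] at h
  simp only [e2] at h
  have hnn : 0 ≤ ∑ i, |v i| ^ t := Finset.sum_nonneg fun i _ => by positivity
  have h3 := Real.rpow_le_rpow (by positivity) h (by positivity : 0 ≤ t / 2)
  rw [← Real.rpow_mul hnn, Real.mul_rpow (by positivity) (by positivity),
    ← Real.rpow_mul (by positivity), ← Real.rpow_natCast M 2, ← Real.rpow_mul hM] at h3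
  have a1 : 2 / t * (t / 2) = 1 := by field_simp
  have a2 : (2 / t - 1) * (t / 2) = 1 - t / 2 := by field_simp
  have a3 : ((2 : ℕ) : ℝ) * (t / 2) = t := by push_cast; ring
  rwa [a1, a2, a3, Real.rpow_one] at h3

lemma aux_norm (d : ℕ) (v : Fin d → ℝ) (M q : ℝ) (hM : 0 < M) (hM2 : ∑ i, v i ^ 2 = M ^ 2)
    (hq : 1 ≤ q) :
    (∑ i, |v i| ^ q) ^ (1 / q) ≤ (d : ℝ) ^ (1 / min q 2 - 1 / 2) * M := by
  have hq0 : 0 < q := by linarith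
  have hnn : 0 ≤ ∑ i, |v i| ^ q := Finset.sum_nonneg fun i _ => by positivity
  rcases le_total q 2 with h | h
  · rw [min_eq_left h]
    have h3 := Real.rpow_le_rpow hnn (aux_pow d v M q hM.le hM2 hq0 h)
      (by positivity : 0 ≤ 1 / q)
    rw [Real.mul_rpow (by positivity) (by positivity),
      ← Real.rpow_mul (by positivity), ← Real.rpow_mul hM.le] at h3
    have a1 : q * (1 / q) = 1 := by field_simp
    have a2 : (1 - q / 2) * (1 / q) = 1 / q - 1 / 2 := by field_simp
    rwa [a1, a2, Real.rpow_one] at h3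
  · rw [min_eq_right h, sub_self, Real.rpow_zero, one_mul]
    have hb : ∑ i, |v i| ^ q ≤ M ^ q := by
      calc ∑ i, |v i| ^ q ≤ ∑ i, v i ^ 2 * M ^ (q - 2) := by
            apply Finset.sum_le_sum
            intro i _
            have hvi : |v i| ≤ M := by
              refine abs_le_of_sq_le_sq ?_ hM.le
              rw [← hM2]
              exact Finset.single_le_sum (f := fun i => v i ^ 2)
                (fun i _ => sq_nonneg _) (Finset.mem_univ i)
            rw [show q = ((2 : ℕ) : ℝ) + (q - 2) by push_cast; ring,
              Real.rpow_add_of_nonneg (abs_nonneg _) (by positivity) (by linarith),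
              Real.rpow_natCast, sq_abs]
            have : |v i| ^ (q - 2) ≤ M ^ (q - 2) :=
              Real.rpow_le_rpow (abs_nonneg _) hvi (by linarith)
            have e : ((2 : ℕ) : ℝ) + (q - 2) - 2 = q - 2 := by push_cast; ring
            rw [e]
            gcongr
        _ = M ^ q := by
            rw [← Finset.sum_mul, hM2, ← Real.rpow_natCast M 2, ← Real.rpow_add hM]
            congr 1; push_cast; ring
    have h3 := Real.rpow_le_rpow hnn hb (by positivity : 0 ≤ 1 / q)
    rw [← Real.rpow_mul hM.le] at h3
    have a1 : q * (1 / q) = 1 := by field_simp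
    rwa [a1, Real.rpow_one] at h3

lemma aux_K (p L r : ℝ) (hp : 0 < p) (hp1 : p < 1) (hr : 0 ≤ r) (hrL : r ≤ L) :
    (L - r) * r ≤ (1 / (2 - p)) * ((1 - p) / (2 - p)) ^ (1 - p) * L ^ (2 - p) * r ^ p := by
  have h2 : 0 < 2 - p := by linarith
  have h1 : 0 < 1 - p := by linarith
  have hw : 0 < (1 - p) / (2 - p) := by positivity
  have hL : 0 ≤ L - r := by linarith
  have h := Real.geom_mean_le_arith_mean2_weighted (w₁ := (1 - p) / (2 - p)) (w₂ := 1 / (2 - p))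
    (p₁ := r / ((1 - p) / (2 - p))) (p₂ := (L - r) * (2 - p)) hw.le (by positivity)
    (by positivity) (by positivity) (by field_simp; ring)
  have e : (1 - p) / (2 - p) * (r / ((1 - p) / (2 - p))) + 1 / (2 - p) * ((L - r) * (2 - p)) = L := by
    field_simp; ring
  rw [e] at h
  have h3 := Real.rpow_le_rpow (by positivity) h h2.le
  rw [Real.mul_rpow (by positivity) (by positivity), ← Real.rpow_mul (by positivity),
    ← Real.rpow_mul (by positivity)] at h3
  have a1 : (1 - p) / (2 - p) * (2 - p) = 1 - p := by field_simp
  have a2 : 1 / (2 - p) * (2 - p) = 1 := by field_simp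
  rw [a1, a2, Real.rpow_one, Real.div_rpow hr hw.le] at h3
  have hW : 0 < ((1 - p) / (2 - p)) ^ (1 - p) := by positivity
  set W := ((1 - p) / (2 - p)) ^ (1 - p)
  have hrr : r = r ^ (1 - p) * r ^ p := by
    rw [← Real.rpow_add_of_nonneg hr h1.le hp.le]; simp
  have hrp : 0 ≤ r ^ p := by positivity
  calc (L - r) * r = (1 / (2 - p)) * W * (r ^ (1 - p) / W * ((L - r) * (2 - p))) * r ^ p := by
        conv_lhs => rw [hrr]
        have : r ^ (1 - p) * r ^ p = r := hrr.symm
        rw [this]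
        field_simp
        linear_combination (-(L - r)) * this
    _ ≤ _ := by gcongr

lemma aux_bin (a b r X : ℝ) (ha : 0 < a) (hab : a < b) (hX : b / a ≤ X) :
    (b - r) * (r - a) ≤ (X - 1) ^ 2 / (4 * X) * r ^ 2 := by
  have h1 : 1 < b / a := by rw [lt_div_iff₀ ha]; linarith
  have hb : 0 < b := by linarith
  have s1 : (b - r) * (r - a) ≤ (b / a - 1) ^ 2 / (4 * (b / a)) * r ^ 2 := by
    have e : (b / a - 1) ^ 2 / (4 * (b / a)) * r ^ 2 = ((b - a) ^ 2 * r ^ 2) / (4 * a * b) := by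
      field_simp
    rw [e, le_div_iff₀ (by positivity)]
    nlinarith [sq_nonneg ((a + b) * r - 2 * a * b)]
  refine s1.trans (mul_le_mul_of_nonneg_right ?_ (sq_nonneg r))
  generalize b / a = x at *
  rw [div_le_div_iff₀ (by linarith) (by linarith)]
  have : 0 ≤ (X - x) * (X * x - 1) := mul_nonneg (by linarith) (by nlinarith)
  nlinarith

/-- Variance bound: Let v ∈ ℝ^d, q ≥ 1, with normalized
coordinates r_i = |v_i|/‖v‖_q, quantization levels
0 = ℓ₀ < ℓ₁ < ... < ℓ_{s+1} = 1, and τ i the bin index of r_i.  The total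
variance of unbiased stochastic quantization,
‖v‖_q² Σ_i (ℓ_{τ i+1} - r_i)(r_i - ℓ_{τ i}), is at most ε_Q ‖v‖₂² with
ε_Q = (ℓ_{j*+1}/ℓ_{j*} - 1)²/(4 ℓ_{j*+1}/ℓ_{j*})
      + K_p ℓ₁^{2-p} d^{(2-p)/min(q,2)},
where j* maximizes ℓ_{j+1}/ℓ_j over 1 ≤ j ≤ s and
K_p = (1/(2-p))((1-p)/(2-p))^{1-p}, for any p ∈ (0,1). -/
theorem stmt11 (d s : ℕ) (hs : 1 ≤ s) (v : Fin d → ℝ) (hv : v ≠ 0)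
    (q p : ℝ) (hq : 1 ≤ q) (hp : 0 < p) (hp1 : p < 1)
    (l : ℕ → ℝ) (hl0 : l 0 = 0) (hls : l (s + 1) = 1)
    (hmono : ∀ j ≤ s, l j < l (j + 1))
    (r : Fin d → ℝ) (hr : ∀ i, r i = |v i| / (∑ j, |v j| ^ q) ^ (1 / q))
    (τ : Fin d → ℕ) (hτ : ∀ i, τ i ≤ s ∧ l (τ i) ≤ r i ∧ r i ≤ l (τ i + 1))
    (jstar : ℕ) (hj1 : 1 ≤ jstar) (hjs : jstar ≤ s)
    (hmax : ∀ j, 1 ≤ j → j ≤ s → l (j + 1) / l j ≤ l (jstar + 1) / l jstar) :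
    ((∑ j, |v j| ^ q) ^ (1 / q)) ^ 2
        * ∑ i, (l (τ i + 1) - r i) * (r i - l (τ i))
      ≤ ((l (jstar + 1) / l jstar - 1) ^ 2 / (4 * (l (jstar + 1) / l jstar))
          + (1 / (2 - p)) * ((1 - p) / (2 - p)) ^ (1 - p) * l 1 ^ (2 - p)
            * (d : ℝ) ^ ((2 - p) / min q 2))
        * ∑ i, (v i) ^ 2 := by
  have hlpos : ∀ j, j ≤ s → 0 < l (j + 1) := by
    intro j
    induction j with
    | zero => intro h; have := hmono 0 h; rw [hl0] at this; exact this
    | succ k ih => intro h; exact (ih (by omega)).trans (hmono (k + 1) h)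
  have hS : 0 < ∑ i, v i ^ 2 := by
    obtain ⟨i, hi⟩ := Function.ne_iff.mp hv
    exact Finset.sum_pos' (fun i _ => sq_nonneg _) ⟨i, Finset.mem_univ i, by
      have : v i ≠ 0 := hi
      positivity⟩
  have hd : 0 < (d : ℝ) := by
    obtain ⟨i, hi⟩ := Function.ne_iff.mp hv
    exact_mod_cast i.pos
  set M := Real.sqrt (∑ i, v i ^ 2) with hMdef
  have hM : 0 < M := Real.sqrt_pos.mpr hS
  have hM2 : ∑ i, v i ^ 2 = M ^ 2 := (Real.sq_sqrt hS.le).symm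
  have hN := aux_norm d v M q hM hM2 hq
  have hNpos : 0 < (∑ j, |v j| ^ q) ^ (1 / q) := by
    apply Real.rpow_pos_of_pos
    obtain ⟨i, hi⟩ := Function.ne_iff.mp hv
    exact Finset.sum_pos' (fun i _ => by positivity) ⟨i, Finset.mem_univ i, by
      have : v i ≠ 0 := hi
      positivity⟩
  set N := (∑ j, |v j| ^ q) ^ (1 / q) with hNdef
  have hsp := aux_pow d v M p hM.le hM2 hp (by linarith)
  have hX : 1 < l (jstar + 1) / l jstar := by
    have h0 : 0 < l jstar := by
      obtain ⟨k, rfl⟩ : ∃ k, jstar = k + 1 := ⟨jstar - 1, by omega⟩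
      exact hlpos k (by omega)
    rw [lt_div_iff₀ h0]; linarith [hmono jstar hjs]
  set X := l (jstar + 1) / l jstar
  have h2 : 0 < 2 - p := by linarith
  have h1 : 0 < 1 - p := by linarith
  have hl1 : 0 < l 1 := hlpos 0 (by omega)
  have hA : 0 ≤ (X - 1) ^ 2 / (4 * X) := by positivity
  set A := (X - 1) ^ 2 / (4 * X)
  have hB : 0 ≤ (1 / (2 - p)) * ((1 - p) / (2 - p)) ^ (1 - p) * l 1 ^ (2 - p) := by positivity
  have hr0 : ∀ i, 0 ≤ r i := fun i => by rw [hr i]; positivity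
  have hterm : ∀ i, (l (τ i + 1) - r i) * (r i - l (τ i)) ≤
      A * r i ^ 2 + (1 / (2 - p)) * ((1 - p) / (2 - p)) ^ (1 - p) * l 1 ^ (2 - p) * r i ^ p := by
    intro i
    obtain ⟨t1, t2, t3⟩ := hτ i
    have hri := hr0 i
    rcases Nat.eq_zero_or_pos (τ i) with h0 | h0
    · rw [h0] at t3 ⊢
      rw [hl0, sub_zero]
      have := aux_K p (l 1) (r i) hp hp1 hri t3
      have : 0 ≤ A * r i ^ 2 := by positivity
      simp only [zero_add]
      linarith
    · have ha : 0 < l (τ i) := by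
        obtain ⟨k, hk⟩ : ∃ k, τ i = k + 1 := ⟨τ i - 1, by omega⟩
        rw [hk]; exact hlpos k (by omega)
      have := aux_bin (l (τ i)) (l (τ i + 1)) (r i) X ha (hmono _ t1) (hmax _ h0 t1)
      have h4 : 0 ≤ r i ^ p := by positivity
      have := mul_nonneg hB h4
      linarith
  set B := (1 / (2 - p)) * ((1 - p) / (2 - p)) ^ (1 - p) * l 1 ^ (2 - p)
  have hs2 : N ^ 2 * ∑ i, r i ^ 2 = M ^ 2 := by
    rw [← hM2, Finset.mul_sum]
    refine Finset.sum_congr rfl fun i _ => ?_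
    rw [hr i, div_pow, sq_abs]; field_simp
  have hspN : N ^ 2 * ∑ i, r i ^ p = N ^ (2 - p) * ∑ i, |v i| ^ p := by
    rw [Finset.mul_sum, Finset.mul_sum]
    refine Finset.sum_congr rfl fun i _ => ?_
    rw [hr i, Real.div_rpow (abs_nonneg _) hNpos.le, Real.rpow_sub hNpos,
      show (2 : ℝ) = ((2 : ℕ) : ℝ) by norm_num, Real.rpow_natCast]
    ring
  have hfin : N ^ (2 - p) * ∑ i, |v i| ^ p ≤ (d : ℝ) ^ ((2 - p) / min q 2) * M ^ 2 := by
    calc N ^ (2 - p) * ∑ i, |v i| ^ p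
        ≤ ((d : ℝ) ^ (1 / min q 2 - 1 / 2) * M) ^ (2 - p) * ((d : ℝ) ^ (1 - p / 2) * M ^ p) := by
          gcongr
      _ = ((d : ℝ) ^ ((1 / min q 2 - 1 / 2) * (2 - p)) * (d : ℝ) ^ (1 - p / 2))
            * (M ^ (2 - p) * M ^ p) := by
          rw [Real.mul_rpow (by positivity) hM.le, ← Real.rpow_mul hd.le]; ring
      _ = _ := by
          rw [← Real.rpow_add hd, ← Real.rpow_add hM, ← Real.rpow_natCast M 2]
          congr 2 <;> push_cast <;> ring
  calc N ^ 2 * ∑ i, (l (τ i + 1) - r i) * (r i - l (τ i))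
      ≤ N ^ 2 * ∑ i, (A * r i ^ 2 + B * r i ^ p) := by
        gcongr with i _
        exact hterm i
    _ = A * (N ^ 2 * ∑ i, r i ^ 2) + B * (N ^ 2 * ∑ i, r i ^ p) := by
        rw [Finset.sum_add_distrib, ← Finset.mul_sum, ← Finset.mul_sum]; ring
    _ ≤ A * M ^ 2 + B * ((d : ℝ) ^ ((2 - p) / min q 2) * M ^ 2) := by
        rw [hs2, hspN]; gcongr
    _ = _ := by rw [hM2]; ring
end

section
/- Let Q̃(b) = ∫_0^b (b^2 - r^2) dF(r) + ∫_b^c (c-r)(r-b) dF(r) for r-distribution with density p > 0 and CDF F on [0,c]. Then Q̃ is strictly convex in b on (0,c), with second derivative b·p(b) + c·p(b) + 2(F(b) - F(0)) > 0, and its unique minimizer b* satisfies 2b*(F(b*) - F(0)) = ∫_{b*}^c (c - r) dF(r). -/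
/-- Let Q̃(b) = ∫_0^b (b² - r²) dF(r) + ∫_b^c (c-r)(r-b) dF(r)
for an r-distribution with continuous density p > 0 and CDF F on [0,c].  Then
Q̃ is strictly convex in b on (0,c), with second derivative
b·p(b) + c·p(b) + 2(F(b) - F(0)) > 0, and its (unique) minimizer b* satisfies
2b*(F(b*) - F(0)) = ∫_{b*}^c (c - r) dF(r). -/
theorem stmt14 (p F : ℝ → ℝ) (c : ℝ) (hc : 0 < c) (hc1 : c ≤ 1)
    (hpcont : Continuous p) (hppos : ∀ x ∈ Set.Icc (0:ℝ) c, 0 < p x)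
    (hF : ∀ x, F x = ∫ r in (0:ℝ)..x, p r)
    (Q : ℝ → ℝ)
    (hQ : ∀ b, Q b = (∫ r in (0:ℝ)..b, (b ^ 2 - r ^ 2) * p r) +
      ∫ r in b..c, (c - r) * (r - b) * p r) :
    StrictConvexOn ℝ (Set.Ioo 0 c) Q ∧
    (∀ b ∈ Set.Ioo (0:ℝ) c,
      deriv (deriv Q) b = b * p b + c * p b + 2 * (F b - F 0) ∧
      0 < b * p b + c * p b + 2 * (F b - F 0)) ∧
    (∀ bstar ∈ Set.Ioo (0:ℝ) c, IsMinOn Q (Set.Icc 0 c) bstar →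
      2 * bstar * (F bstar - F 0) = ∫ r in bstar..c, (c - r) * p r) := by
  have hr : ∀ g : ℝ → ℝ, Continuous g → ∀ b : ℝ,
      HasDerivAt (fun b => ∫ r in (0:ℝ)..b, g r) (g b) b := fun g hg b =>
    intervalIntegral.integral_hasDerivAt_right (hg.intervalIntegrable _ _)
      (hg.stronglyMeasurableAtFilter _ _) hg.continuousAt
  have hl : ∀ g : ℝ → ℝ, Continuous g → ∀ b : ℝ,
      HasDerivAt (fun b => ∫ r in b..c, g r) (-g b) b := fun g hg b =>
    intervalIntegral.integral_hasDerivAt_left (hg.intervalIntegrable _ _)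
      (hg.stronglyMeasurableAtFilter _ _) hg.continuousAt
  have c2 : Continuous (fun r => r ^ 2 * p r) := by fun_prop
  have c3 : Continuous (fun r => (c - r) * r * p r) := by fun_prop
  have c4 : Continuous (fun r => (c - r) * p r) := by fun_prop
  have hF0 : F 0 = 0 := by simp [hF]
  have hFd : ∀ b, HasDerivAt F (p b) b := by
    intro b
    have := hr p hpcont b
    rwa [← funext hF] at this
  have hQe : Q = fun b => (b ^ 2 * F b - ∫ r in (0:ℝ)..b, r ^ 2 * p r) +
      ((∫ r in b..c, (c - r) * r * p r) - b * ∫ r in b..c, (c - r) * p r) := by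
    funext b
    rw [hQ, hF, ← intervalIntegral.integral_const_mul, ← intervalIntegral.integral_const_mul,
      ← intervalIntegral.integral_sub, ← intervalIntegral.integral_sub]
    · congr 1
      · congr 1; funext r; ring
      · congr 1; funext r; ring
    all_goals exact Continuous.intervalIntegrable (by fun_prop) _ _
  have hQd : ∀ b, HasDerivAt Q (2 * b * F b - ∫ r in b..c, (c - r) * p r) b := by
    intro b
    rw [hQe]
    have h := ((((hasDerivAt_id b).pow 2).mul (hFd b)).sub (hr _ c2 b)).add
      ((hl _ c3 b).sub ((hasDerivAt_id b).mul (hl _ c4 b)))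
    refine h.congr_deriv ?_
    simp
    ring
  have hd : deriv Q = fun b => 2 * b * F b - ∫ r in b..c, (c - r) * p r :=
    funext fun b => (hQd b).deriv
  have hdd : ∀ b, deriv (deriv Q) b = b * p b + c * p b + 2 * (F b - F 0) := by
    intro b
    rw [hd]
    have h := ((((hasDerivAt_id b).const_mul 2).mul (hFd b)).sub (hl _ c4 b))
    refine HasDerivAt.deriv (h.congr_deriv ?_)
    simp [hF0]
    ring
  have hpos : ∀ b ∈ Set.Ioo (0:ℝ) c, 0 < b * p b + c * p b + 2 * (F b - F 0) := by
    intro b hb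
    have h1 := hppos b ⟨hb.1.le, hb.2.le⟩
    have h2 : 0 ≤ F b := by
      rw [hF]
      exact intervalIntegral.integral_nonneg hb.1.le
        fun x hx => (hppos x ⟨hx.1, hx.2.trans hb.2.le⟩).le
    have h3 := mul_pos hb.1 h1
    have h4 := mul_pos hc h1
    rw [hF0]
    linarith
  refine ⟨?_, fun b hb => ⟨hdd b, hpos b hb⟩, ?_⟩
  · apply strictConvexOn_of_deriv2_pos (convex_Ioo 0 c)
      (fun b _ => (hQd b).continuousAt.continuousWithinAt)
    intro b hb
    rw [interior_Ioo] at hb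
    have := hpos b hb
    rw [← hdd b] at this
    exact this
  · intro b hb hmin
    have h := (hmin.isLocalMin (Icc_mem_nhds hb.1 hb.2)).hasDerivAt_eq_zero (hQd b)
    rw [hF0]
    linarith
end
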